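/- (Gyrocovariance of gyrobarycentric coordinate representations) Let A₁, …, A_N be points of the c-ball V_c and let m₁, …, m_N be real numbers with Σ_{k=1}^N m_k·γ_{A_k} > 0, and set P = (Σ_{k=1}^N m_k·γ_{A_k}·A_k)/(Σ_{k=1}^N m_k·γ_{A_k}). Assume ‖P‖ < c. Then, with m₀ = √((Σ_{k=1}^N m_k)² + 2·Σ_{1 ≤ j < k ≤ N} m_j·m_k·(γ_{⊖A_j ⊕ A_k} − 1)), one has (i) γ_P = (Σ_{k=1}^N m_k·γ_{A_k})/m₀ and γ_P·P = (Σ_{k=1}^N m_k·γ_{A_k}·A_k)/m₀; and (ii) for every X ∈ V_c, X ⊕ P = (Σ_{k=1}^N m_k·γ_{X ⊕ A_k}·(X ⊕ A_k))/(Σ_{k=1}^N m_k·γ_{X ⊕ A_k}), i.e., the representation is covariant under left gyrotranslations. -/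

import Mathlib

open scoped RealInnerProductSpace

noncomputable def gamma {V : Type*} [NormedAddCommGroup V] [InnerProductSpace ℝ V]
    (c : ℝ) (u : V) : ℝ :=
  1 / Real.sqrt (1 - ‖u‖ ^ 2 / c ^ 2)

noncomputable def eAdd {V : Type*} [NormedAddCommGroup V] [InnerProductSpace ℝ V]
    (c : ℝ) (u v : V) : V :=
  (1 / (1 + ⟪u, v⟫ / c ^ 2)) •
    (u + (1 / gamma c u) • v +
      ((1 / c ^ 2) * (gamma c u / (1 + gamma c u)) * ⟪u, v⟫) • u)

noncomputable def eGyr {V : Type*} [NormedAddCommGroup V] [InnerProductSpace ℝ V]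
    (c : ℝ) (u v w : V) : V :=
  eAdd c (-(eAdd c u v)) (eAdd c u (eAdd c v w))

noncomputable def eCoadd {V : Type*} [NormedAddCommGroup V] [InnerProductSpace ℝ V]
    (c : ℝ) (u v : V) : V :=
  eAdd c u (eGyr c u (-v) v)

noncomputable def mAdd {V : Type*} [NormedAddCommGroup V] [InnerProductSpace ℝ V]
    (s : ℝ) (u v : V) : V :=
  (1 / (1 + (2 / s ^ 2) * ⟪u, v⟫ + (1 / s ^ 4) * ‖u‖ ^ 2 * ‖v‖ ^ 2)) •
    ((1 + (2 / s ^ 2) * ⟪u, v⟫ + (1 / s ^ 2) * ‖v‖ ^ 2) • u +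
      (1 - (1 / s ^ 2) * ‖u‖ ^ 2) • v)

noncomputable def mGyr {V : Type*} [NormedAddCommGroup V] [InnerProductSpace ℝ V]
    (s : ℝ) (u v w : V) : V :=
  mAdd s (-(mAdd s u v)) (mAdd s u (mAdd s v w))

noncomputable def mCoadd {V : Type*} [NormedAddCommGroup V] [InnerProductSpace ℝ V]
    (s : ℝ) (u v : V) : V :=
  mAdd s u (mGyr s u (-v) v)

noncomputable def artanh (x : ℝ) : ℝ :=
  (1 / 2) * Real.log ((1 + x) / (1 - x))

open Classical in
noncomputable def sMul {V : Type*} [NormedAddCommGroup V] [InnerProductSpace ℝ V]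
    (c : ℝ) (r : ℝ) (v : V) : V :=
  if v = 0 then 0 else (c * Real.tanh (r * artanh (‖v‖ / c)) / ‖v‖) • v

variable {V : Type*} [NormedAddCommGroup V] [InnerProductSpace ℝ V]

theorem one_sub_normSq_div_pos {E : Type*} [NormedAddCommGroup E] {c : ℝ} (hc : 0 < c) {u : E}
    (hu : ‖u‖ < c) :
    0 < 1 - ‖u‖ ^ 2 / c ^ 2 := by
  rw [sub_pos, div_lt_one (by positivity)]
  exact pow_lt_pow_left₀ hu (norm_nonneg u) two_ne_zero

theorem gamma_pos {c : ℝ} (hc : 0 < c) {u : V} (hu : ‖u‖ < c) : 0 < gamma c u :=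
  one_div_pos.2 (Real.sqrt_pos.2 (one_sub_normSq_div_pos hc hu))

theorem gamma_sq_mul {c : ℝ} (hc : 0 < c) {u : V} (hu : ‖u‖ < c) :
    gamma c u ^ 2 * (1 - ‖u‖ ^ 2 / c ^ 2) = 1 := by
  have h := one_sub_normSq_div_pos hc hu
  rw [gamma, div_pow, Real.sq_sqrt h.le, one_pow, one_div_mul_cancel h.ne']

theorem gamma_neg (c : ℝ) (u : V) : gamma c (-u) = gamma c u := by
  simp [gamma]

theorem one_add_inner_div_pos {c : ℝ} (hc : 0 < c) {u v : V} (hu : ‖u‖ < c) (hv : ‖v‖ < c) :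
    0 < 1 + ⟪u, v⟫ / c ^ 2 := by
  have h : |⟪u, v⟫| < c ^ 2 := calc
    |⟪u, v⟫| ≤ ‖u‖ * ‖v‖ := abs_real_inner_le_norm u v
    _ < c * c := mul_lt_mul'' hu hv (norm_nonneg u) (norm_nonneg v)
    _ = c ^ 2 := (sq c).symm
  have h' : -1 < ⟪u, v⟫ / c ^ 2 := by
    rw [lt_div_iff₀ (by positivity)]
    linarith [(abs_lt.1 h).1]
  linarith

theorem one_sub_normSq_eAdd_div {c : ℝ} (hc : 0 < c) {u v : V} (hu : ‖u‖ < c) (hv : ‖v‖ < c) :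
    (1 + ⟪u, v⟫ / c ^ 2) ^ 2 * (1 - ‖eAdd c u v‖ ^ 2 / c ^ 2) =
      (1 - ‖u‖ ^ 2 / c ^ 2) * (1 - ‖v‖ ^ 2 / c ^ 2) := by
  have hd := (one_add_inner_div_pos hc hu hv).ne'
  have hg := gamma_pos hc hu
  have hg2 := gamma_sq_mul hc hu
  set g := gamma c u with hgdef
  set d := 1 + ⟪u, v⟫ / c ^ 2 with hddef
  have hnorm : d ^ 2 * ‖eAdd c u v‖ ^ 2 =
      (1 + 1 / c ^ 2 * (g / (1 + g)) * ⟪u, v⟫) ^ 2 * ‖u‖ ^ 2 +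
        2 * (1 + 1 / c ^ 2 * (g / (1 + g)) * ⟪u, v⟫) * (1 / g) * ⟪u, v⟫ +
        (1 / g) ^ 2 * ‖v‖ ^ 2 := by
    have he : d • eAdd c u v =
        (1 + 1 / c ^ 2 * (g / (1 + g)) * ⟪u, v⟫) • u + (1 / g) • v := by
      rw [eAdd, smul_smul, ← hddef, ← hgdef, mul_one_div_cancel hd]
      module
    have hn := congrArg (fun w : V => ‖w‖ ^ 2) he
    simp only [norm_add_sq_real, norm_smul, mul_pow, Real.norm_eq_abs, sq_abs,
      real_inner_smul_left, real_inner_smul_right] at hn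
    linarith
  have hu2 : ‖u‖ ^ 2 = c ^ 2 * (1 - 1 / g ^ 2) := by
    field_simp at hg2 ⊢
    linarith
  have h1g : 1 + g ≠ 0 := by positivity
  rw [mul_sub, mul_div_assoc', hnorm, hddef, hu2]
  field_simp
  ring

theorem gamma_eAdd {c : ℝ} (hc : 0 < c) {u v : V} (hu : ‖u‖ < c) (hv : ‖v‖ < c) :
    gamma c (eAdd c u v) = gamma c u * gamma c v * (1 + ⟪u, v⟫ / c ^ 2) := by
  have hd := one_add_inner_div_pos hc hu hv
  have hq : 1 - ‖eAdd c u v‖ ^ 2 / c ^ 2 =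
      (1 - ‖u‖ ^ 2 / c ^ 2) * (1 - ‖v‖ ^ 2 / c ^ 2) / (1 + ⟪u, v⟫ / c ^ 2) ^ 2 := by
    rw [← one_sub_normSq_eAdd_div hc hu hv, mul_div_cancel_left₀ _ (pow_ne_zero 2 hd.ne')]
  have hup := one_sub_normSq_div_pos hc hu
  rw [gamma, hq, Real.sqrt_div' _ (sq_nonneg _), Real.sqrt_sq hd.le, Real.sqrt_mul hup.le,
    gamma, gamma, one_div_div, div_mul_div_comm, one_mul, div_mul_eq_mul_div, one_mul]

theorem gamma_smul_eAdd {c : ℝ} (hc : 0 < c) {u v : V} (hu : ‖u‖ < c) (hv : ‖v‖ < c) :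
    gamma c (eAdd c u v) • eAdd c u v = (gamma c u * gamma c v) •
      (u + (1 / gamma c u) • v + ((1 / c ^ 2) * (gamma c u / (1 + gamma c u)) * ⟪u, v⟫) • u) := by
  have hd := (one_add_inner_div_pos hc hu hv).ne'
  rw [gamma_eAdd hc hu hv, eAdd, smul_smul, mul_assoc _ (1 + _), mul_one_div_cancel hd, mul_one]

theorem gamma_neg_eAdd {c : ℝ} (hc : 0 < c) {u v : V} (hu : ‖u‖ < c) (hv : ‖v‖ < c) :
    gamma c (eAdd c (-u) v) = gamma c u * gamma c v * (1 - ⟪u, v⟫ / c ^ 2) := by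
  rw [gamma_eAdd hc (by rwa [norm_neg]) hv, gamma_neg, inner_neg_left, neg_div, ← sub_eq_add_neg]

theorem sum_sum_eq_two_mul_sum_lt {ι : Type*} [Fintype ι] [LinearOrder ι] (f : ι → ι → ℝ)
    (hsymm : ∀ j k, f j k = f k j) (hdiag : ∀ j, f j j = 0) :
    ∑ j, ∑ k, f j k = 2 * ∑ j, ∑ k, if j < k then f j k else 0 := by
  have hsplit : ∀ j k, f j k = (if j < k then f j k else 0) + if k < j then f k j else 0 := by
    intro j k
    rcases lt_trichotomy j k with h | rfl | h
    · simp [h, h.not_gt]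
    · simp [hdiag]
    · simp [h, h.not_gt, hsymm j k]
  calc ∑ j, ∑ k, f j k
      = ∑ j, ∑ k, ((if j < k then f j k else 0) + if k < j then f k j else 0) :=
        Finset.sum_congr rfl fun j _ => Finset.sum_congr rfl fun k _ => hsplit j k
    _ = 2 * ∑ j, ∑ k, if j < k then f j k else 0 := by
        simp only [Finset.sum_add_distrib]
        rw [Finset.sum_comm (f := fun j k => if k < j then f k j else 0)]
        ring

theorem sq_sum_add_two_mul_sum_gamma {ι : Type*} [Fintype ι] [LinearOrder ι] {c : ℝ} (hc : 0 < c)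
    {A : ι → V} (hA : ∀ k, ‖A k‖ < c) (m : ι → ℝ) :
    (∑ k, m k) ^ 2 +
        2 * ∑ j, ∑ k,
          (if j < k then m j * m k * (gamma c (eAdd c (-(A j)) (A k)) - 1) else 0) =
      (∑ k, m k * gamma c (A k)) ^ 2 - ‖∑ k, (m k * gamma c (A k)) • A k‖ ^ 2 / c ^ 2 := by
  rw [← sum_sum_eq_two_mul_sum_lt
    (fun j k => m j * m k * (gamma c (eAdd c (-(A j)) (A k)) - 1))]
  · rw [← real_inner_self_eq_norm_sq, sum_inner, sq, sq, Finset.sum_mul_sum, Finset.sum_mul_sum,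
      Finset.sum_div, ← Finset.sum_add_distrib, ← Finset.sum_sub_distrib]
    refine Finset.sum_congr rfl fun j _ => ?_
    rw [inner_sum, Finset.sum_div, ← Finset.sum_add_distrib, ← Finset.sum_sub_distrib]
    refine Finset.sum_congr rfl fun k _ => ?_
    rw [gamma_neg_eAdd hc (hA j) (hA k), real_inner_smul_left, real_inner_smul_right]
    ring
  · intro j k
    rw [gamma_neg_eAdd hc (hA j) (hA k), gamma_neg_eAdd hc (hA k) (hA j), real_inner_comm]
    ring
  · intro j
    rw [gamma_neg_eAdd hc (hA j) (hA j), real_inner_self_eq_norm_sq, ← sq (gamma c (A j)),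
      gamma_sq_mul hc (hA j), sub_self, mul_zero]

theorem gyrobarycentric_covariance (c : ℝ) (hc : 0 < c)
    (N : ℕ) (A : Fin N → V) (m : Fin N → ℝ)
    (hA : ∀ k, ‖A k‖ < c)
    (hm : 0 < ∑ k, m k * gamma c (A k))
    (P : V)
    (hPdef : P = (1 / ∑ k, m k * gamma c (A k)) • ∑ k, (m k * gamma c (A k)) • A k)
    (hP : ‖P‖ < c)
    (m₀ : ℝ)
    (hm₀ : m₀ = Real.sqrt ((∑ k, m k) ^ 2 +
      2 * ∑ j, ∑ k,
        if j < k then m j * m k * (gamma c (eAdd c (-(A j)) (A k)) - 1) else 0)) :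
    gamma c P = (∑ k, m k * gamma c (A k)) / m₀ ∧
    gamma c P • P = (1 / m₀) • ∑ k, (m k * gamma c (A k)) • A k ∧
    ∀ X : V, ‖X‖ < c →
      eAdd c X P =
        (1 / ∑ k, m k * gamma c (eAdd c X (A k))) •
          ∑ k, (m k * gamma c (eAdd c X (A k))) • (eAdd c X (A k)) := by
  set S := ∑ k, m k * gamma c (A k) with hS
  set W := ∑ k, (m k * gamma c (A k)) • A k with hW
  have hWP : W = S • P := by
    rw [hPdef, smul_smul, mul_one_div_cancel hm.ne', one_smul]
  have hg := gamma_pos hc hP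
  have hm₀S : m₀ = S / gamma c P := by
    rw [hm₀, sq_sum_add_two_mul_sum_gamma hc hA, ← hS, ← hW, hWP, norm_smul, mul_pow,
      Real.norm_eq_abs, sq_abs, mul_div_assoc, ← mul_one_sub, Real.sqrt_mul (sq_nonneg S),
      Real.sqrt_sq hm.le, gamma, div_div_eq_mul_div, div_one]
  have hγ : gamma c P = S / m₀ := by
    rw [hm₀S, div_div_cancel₀ hm.ne']
  refine ⟨hγ, ?_, fun X hX => ?_⟩
  · rw [hγ, hWP, smul_smul, one_div_mul_eq_div]
  have hX0 := gamma_pos hc hX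
  have hinner : ∑ k, m k * gamma c (A k) * ⟪X, A k⟫ = S * ⟪X, P⟫ := by
    rw [← real_inner_smul_right, ← hWP, hW, inner_sum]
    simp only [real_inner_smul_right]
  have hden : ∑ k, m k * gamma c (eAdd c X (A k)) =
      gamma c X * S * (1 + ⟪X, P⟫ / c ^ 2) := by
    calc ∑ k, m k * gamma c (eAdd c X (A k))
        = ∑ k, (gamma c X * (m k * gamma c (A k)) +
            gamma c X / c ^ 2 * (m k * gamma c (A k) * ⟪X, A k⟫)) :=
          Finset.sum_congr rfl fun k _ => by rw [gamma_eAdd hc hX (hA k)]; ring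
      _ = gamma c X * S * (1 + ⟪X, P⟫ / c ^ 2) := by
          rw [Finset.sum_add_distrib, ← Finset.mul_sum, ← Finset.mul_sum, hinner]
          ring
  have hnum : ∑ k, (m k * gamma c (eAdd c X (A k))) • eAdd c X (A k) =
      (gamma c X * S) • (X + (1 / gamma c X) • P +
        ((1 / c ^ 2) * (gamma c X / (1 + gamma c X)) * ⟪X, P⟫) • X) := by
    set t := (1 / c ^ 2) * (gamma c X / (1 + gamma c X))
    calc ∑ k, (m k * gamma c (eAdd c X (A k))) • eAdd c X (A k)
        = ∑ k, (gamma c X • ((m k * gamma c (A k)) • X) +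
            (gamma c X * (1 / gamma c X)) • ((m k * gamma c (A k)) • A k) +
            (gamma c X * t) • ((m k * gamma c (A k) * ⟪X, A k⟫) • X)) :=
          Finset.sum_congr rfl fun k _ => by
            rw [mul_smul, gamma_smul_eAdd hc hX (hA k)]
            module
      _ = _ := by
          rw [Finset.sum_add_distrib, Finset.sum_add_distrib, ← Finset.smul_sum,
            ← Finset.smul_sum, ← Finset.smul_sum, ← Finset.sum_smul, ← Finset.sum_smul, hinner,
            ← hS, ← hW, hWP]
          module
  have hd := one_add_inner_div_pos hc hX hP
  rw [hden, hnum, smul_smul, eAdd]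
  congr 1
  field_simp
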